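/- (Generalized Lauritzen formula.) The map 𝒫 → 𝒬, y ↦ π(y^{−1}), is a bijection, and its inverse is given explicitly by m ↦ m̂^{−1} = n_r φ_r*(φ_r(m)^{−1}) + Σ_{i=1}^{r−1} n_i ( φ_i*(φ_i(m)^{−1}) − φ̌_i*(φ̌_i(m)^{−1}) ) for m ∈ 𝒬, where n = (n_1,…,n_r). -/

import Mathlib

open Matrix MeasureTheory Finset
open scoped ENNReal

namespace Wishart

instance {m n α : Type*} [MeasurableSpace α] : MeasurableSpace (Matrix m n α) :=
  inferInstanceAs (MeasurableSpace (m → n → α))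

/-- Index set of an `N × N` matrix partitioned into `r + 1` blocks of sizes `n 0, …, n r`. -/
abbrev Idx (r : ℕ) (n : Fin (r + 1) → ℕ+) := Σ k : Fin (r + 1), Fin (n k)

/-- Real matrices over the partitioned index set. -/
abbrev Mat (r : ℕ) (n : Fin (r + 1) → ℕ+) := Matrix (Idx r n) (Idx r n) ℝ

variable {r : ℕ} {n : Fin (r + 1) → ℕ+}

/-- The `(l,k)` block of a partitioned matrix. -/
def blk (x : Mat r n) (l k : Fin (r + 1)) : Matrix (Fin (n l)) (Fin (n k)) ℝ :=
  Matrix.of fun a b => x ⟨l, a⟩ ⟨k, b⟩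

variable (V : ∀ l k : Fin (r + 1), Submodule ℝ (Matrix (Fin (n l)) (Fin (n k)) ℝ))

/-- Condition (V1): `A ∈ 𝒱_{lk}`, `B ∈ 𝒱_{ki}` implies `A B ∈ 𝒱_{li}` for `i < k < l`. -/
def CondV1 : Prop := ∀ i k l : Fin (r + 1), i < k → k < l →
  ∀ A ∈ V l k, ∀ B ∈ V k i, A * B ∈ V l i

/-- Condition (V2): `A ∈ 𝒱_{li}`, `B ∈ 𝒱_{ki}` implies `A Bᵀ ∈ 𝒱_{lk}` for `i < k < l`. -/
def CondV2 : Prop := ∀ i k l : Fin (r + 1), i < k → k < l →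
  ∀ A ∈ V l i, ∀ B ∈ V k i, A * Bᵀ ∈ V l k

/-- Condition (V3): `A ∈ 𝒱_{lk}` implies `A Aᵀ ∈ ℝ I`. -/
def CondV3 : Prop := ∀ k l : Fin (r + 1), k < l →
  ∀ A ∈ V l k, ∃ c : ℝ, A * Aᵀ = c • (1 : Matrix (Fin (n l)) (Fin (n l)) ℝ)

/-- The space `𝒵` of symmetric matrices with lower blocks in `𝒱_{lk}` and scalar diagonal
blocks. -/
def Zspace : Set (Mat r n) :=
  {x | x.IsSymm ∧ (∀ k l : Fin (r + 1), k < l → blk x l k ∈ V l k) ∧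
    ∀ k : Fin (r + 1), ∃ c : ℝ, ∀ a b : Fin (n k),
      x ⟨k, a⟩ ⟨k, b⟩ = if a = b then c else 0}

/-- The trace inner product `⟨x, y⟩ = tr (x y)`. -/
def tip (x y : Mat r n) : ℝ := (x * y).trace

/-- The homogeneous cone `𝒫 = 𝒵 ∩ Sym₊(N, ℝ)`. -/
def Pcone : Set (Mat r n) := {x | x ∈ Zspace V ∧ x.PosDef}

/-- The dual cone `𝒬 = {ξ ∈ 𝒵 : ⟨ξ, x⟩ > 0 for all nonzero x in the closure of 𝒫}`. -/
def Qcone : Set (Mat r n) :=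
  {ξ | ξ ∈ Zspace V ∧ ∀ x ∈ closure (Pcone V), x ≠ 0 → 0 < tip ξ x}

/-- The group `H` of block lower triangular matrices with strictly lower blocks in `𝒱_{lk}`
and positive scalar diagonal blocks. -/
def Hgrp : Set (Mat r n) :=
  {T | (∀ k l : Fin (r + 1), l < k → blk T l k = 0) ∧
    (∀ k l : Fin (r + 1), k < l → blk T l k ∈ V l k) ∧
    ∀ k : Fin (r + 1), ∃ t : ℝ, 0 < t ∧ ∀ a b : Fin (n k),
      T ⟨k, a⟩ ⟨k, b⟩ = if a = b then t else 0}

/-- `ρ(T) x = T x Tᵀ`. -/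
def rhoM (T x : Mat r n) : Mat r n := T * x * Tᵀ

/-- The diagonal scalar `t_{kk}` of a matrix with scalar diagonal blocks. -/
def tdiag (T : Mat r n) (k : Fin (r + 1)) : ℝ :=
  T ⟨k, ⟨0, (n k).2⟩⟩ ⟨k, ⟨0, (n k).2⟩⟩

/-- The one-dimensional representation `χ_s(T) = ∏_k t_{kk}^{2 s_k}`. -/
noncomputable def chi (s : Fin (r + 1) → ℝ) (T : Mat r n) : ℝ :=
  ∏ k : Fin (r + 1), tdiag T k ^ (2 * s k)

/-- `½ Σ_{i<k} ε_i dim 𝒱_{ki}`. -/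
noncomputable def xiBound (ε : Fin (r + 1) → Bool) (k : Fin (r + 1)) : ℝ :=
  (1 / 2) * ∑ i ∈ Finset.univ.filter (fun i => i < k),
    (if ε i then (Module.finrank ℝ (V k i) : ℝ) else 0)

/-- The Gindikin set `Ξ`. -/
def XiSet : Set (Fin (r + 1) → ℝ) :=
  ⋃ ε : Fin (r + 1) → Bool,
    {s | ∀ k, (ε k = true → xiBound V ε k < s k) ∧ (ε k = false → s k = xiBound V ε k)}

/-- `½ Σ_{l>k} ε_l dim 𝒱_{lk}`. -/
noncomputable def frakBound (ε : Fin (r + 1) → Bool) (k : Fin (r + 1)) : ℝ :=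
  (1 / 2) * ∑ l ∈ Finset.univ.filter (fun l => k < l),
    (if ε l then (Module.finrank ℝ (V l k) : ℝ) else 0)

/-- The Gindikin set `𝔛`. -/
def frakX : Set (Fin (r + 1) → ℝ) :=
  ⋃ ε : Fin (r + 1) → Bool,
    {s | ∀ k, (ε k = true → frakBound V ε k < s k) ∧ (ε k = false → s k = frakBound V ε k)}

/-- Laplace transform `L_μ(θ) = ∫ e^{-⟨θ,x⟩} dμ(x)` (with values in `[0,∞]`). -/
noncomputable def laplace (μ : Measure (Mat r n)) (θ : Mat r n) : ℝ≥0∞ :=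
  ∫⁻ x, ENNReal.ofReal (Real.exp (-(tip θ x))) ∂μ

/-- Real-valued Laplace transform. -/
noncomputable def laplaceR (μ : Measure (Mat r n)) (θ : Mat r n) : ℝ :=
  ∫ x, Real.exp (-(tip θ x)) ∂μ

/-- Mean of the natural-exponential-family member `P(θ,μ)`, computed entrywise:
`m_μ(θ) = L_μ(θ)⁻¹ ∫ x e^{-⟨θ,x⟩} dμ(x)`. -/
noncomputable def meanMap (μ : Measure (Mat r n)) (θ : Mat r n) : Mat r n :=
  Matrix.of fun p q => (laplaceR μ θ)⁻¹ * ∫ x, Real.exp (-(tip θ x)) * x p q ∂μ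

/-- Covariance operator of `P(θ,μ)` with mean `m`, applied to `ξ ∈ 𝒵` (entrywise):
`V ξ = ∫ ⟨ξ, x - m⟩ (x - m) dP(θ,μ)(x)`. -/
noncomputable def varOp (μ : Measure (Mat r n)) (θ m ξ : Mat r n) : Mat r n :=
  Matrix.of fun p q =>
    (laplaceR μ θ)⁻¹ * ∫ x, Real.exp (-(tip θ x)) * tip ξ (x - m) * ((x - m) p q) ∂μ

/-- Leading principal submatrix `y_{{1:k}}` consisting of the blocks with indices `≤ k`. -/
def lead (k : Fin (r + 1)) (y : Mat r n) :
    Matrix {p : Idx r n // p.1 ≤ k} {p : Idx r n // p.1 ≤ k} ℝ :=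
  Matrix.of fun p q => y p.1 q.1

/-- Zero-padding `z₀` of a matrix `z` defined on the blocks with indices `≤ k`. -/
def pad (k : Fin (r + 1)) (z : Matrix {p : Idx r n // p.1 ≤ k} {p : Idx r n // p.1 ≤ k} ℝ) :
    Mat r n :=
  Matrix.of fun p q => if h : p.1 ≤ k ∧ q.1 ≤ k then z ⟨p, h.1⟩ ⟨q, h.2⟩ else 0

/-- `J_k = (I_{N_k})₀`. -/
def Jmat (k : Fin (r + 1)) : Mat r n := pad k 1

/-- Parameters of elements of `W_i`: the scalar `x_{ii}` and the blocks `X_{li}`. -/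
abbrev Wparam (r : ℕ) (n : Fin (r + 1) → ℕ+) (i : Fin (r + 1)) :=
  ℝ × ∀ l : Fin (r + 1), Matrix (Fin (n l)) (Fin (n i)) ℝ

/-- The `N × n_i` matrix in `W_i` with `i`-th block row `x_{ii} I` and `l`-th block row
`X_{li}` for `l > i`. -/
def toW (i : Fin (r + 1)) (p : Wparam r n i) : Matrix (Idx r n) (Fin (n i)) ℝ :=
  Matrix.of fun q b =>
    if q.1 = i then (if (q.2 : ℕ) = (b : ℕ) then p.1 else 0)
    else if i < q.1 then p.2 q.1 q.2 b else 0

/-- A parameter tuple gives an honest element of `W_i`: blocks lie in `𝒱_{li}` and vanish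
for `l ≤ i`. -/
def WGood (i : Fin (r + 1)) (p : Wparam r n i) : Prop :=
  (∀ l : Fin (r + 1), i < l → p.2 l ∈ V l i) ∧ (∀ l : Fin (r + 1), ¬ i < l → p.2 l = 0)

/-- The inner product `(A|B)` on `𝒱_{lk}`, characterized by `(ABᵀ + BAᵀ)/2 = (A|B) I`. -/
noncomputable def bip (l : Fin (r + 1)) {k : Fin (r + 1)}
    (A B : Matrix (Fin (n l)) (Fin (n k)) ℝ) : ℝ :=
  (A * Bᵀ).trace / (n l : ℝ)

open scoped Classical in
/-- The generalized power function `Δ_s` on `𝒫`, defined by `Δ_s(ρ(T) I) = χ_s(T)`. -/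
noncomputable def DeltaDef (s : Fin (r + 1) → ℝ) (x : Mat r n) : ℝ :=
  if h : ∃ T, T ∈ Hgrp V ∧ x = rhoM T 1 then chi s h.choose else 0

/-- Index set for the block diagonal matrix `Φ(ξ) = diag(φ_0(ξ), …, φ_r(ξ))`,
where `φ_i(ξ)` is of size `m_i = mdc i + 1`. -/
abbrev DIdx (r : ℕ) (mdc : Fin (r + 1) → ℕ) := Σ i : Fin (r + 1), Fin (mdc i + 1)

/-- The block diagonal matrix `Φ(ξ) = diag(φ_0(ξ), …, φ_r(ξ))`. -/
def PhiMat {mdc : Fin (r + 1) → ℕ}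
    (φ : ∀ i : Fin (r + 1), Mat r n → Matrix (Fin (mdc i + 1)) (Fin (mdc i + 1)) ℝ)
    (ξ : Mat r n) : Matrix (DIdx r mdc) (DIdx r mdc) ℝ :=
  Matrix.of fun p q =>
    if h : p.1 = q.1 then φ p.1 ξ p.2 (Fin.cast (by rw [h]) q.2) else 0

/-- `Φ(I_N)^{-1/2}`: the inverse square root of the (diagonal, positive) matrix `Φ(I_N)`. -/
noncomputable def PhiISqrtInv {mdc : Fin (r + 1) → ℕ}
    (φ : ∀ i : Fin (r + 1), Mat r n → Matrix (Fin (mdc i + 1)) (Fin (mdc i + 1)) ℝ) :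
    Matrix (DIdx r mdc) (DIdx r mdc) ℝ :=
  Matrix.diagonal fun p => (PhiMat φ (1 : Mat r n) p p) ^ (-(1 / 2) : ℝ)

/-! ### Positive definite matrices -/

section PositiveDefinite

open scoped MatrixOrder ComplexOrder

variable {ι : Type*} [Fintype ι]

theorem posSemidef_of_mem_closure {S : Set (Matrix ι ι ℝ)} (hS : ∀ x ∈ S, x.PosSemidef)
    {x : Matrix ι ι ℝ} (hx : x ∈ closure S) : x.PosSemidef := by
  have hcl₁ : IsClosed {x : Matrix ι ι ℝ | xᴴ = x} := isClosed_eq (by fun_prop) continuous_id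
  have hcl₂ (v : ι → ℝ) : IsClosed {x : Matrix ι ι ℝ | 0 ≤ star v ⬝ᵥ x *ᵥ v} :=
    isClosed_le continuous_const (by fun_prop)
  exact .of_dotProduct_mulVec_nonneg (closure_minimal (fun x hx => (hS x hx).1) hcl₁ hx) fun v =>
    closure_minimal (fun x hx => (hS x hx).dotProduct_mulVec_nonneg v) (hcl₂ v) hx

variable [DecidableEq ι]

theorem trace_mul_nonneg_of_posDef {A x : Matrix ι ι ℝ} (hA : A.PosDef) (hx : x.PosSemidef) :
    0 ≤ (A * x).trace ∧ ((A * x).trace = 0 → x = 0) := by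
  obtain ⟨C, hC⟩ := CStarAlgebra.nonneg_iff_eq_star_mul_self.mp hA.posSemidef.nonneg
  have hU : IsUnit C := by
    have h := hA.isUnit
    rw [isUnit_iff_isUnit_det, hC, det_mul] at h
    exact (isUnit_iff_isUnit_det _).2 (isUnit_of_mul_isUnit_right h)
  have htr : (A * x).trace = (C * x * Cᴴ).trace := by
    rw [hC, star_eq_conjTranspose, mul_assoc, trace_mul_comm]
  have hps := hx.mul_mul_conjTranspose_same C
  rw [htr]
  refine ⟨hps.trace_nonneg, fun h0 => ?_⟩
  have h1 : C * x * Cᴴ = 0 := hps.trace_eq_zero_iff.1 h0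
  have hU' : IsUnit Cᴴ := hU.star
  rw [hU'.mul_left_eq_zero, hU.mul_right_eq_zero] at h1
  exact h1

theorem trace_mul_pos_of_posDef {A x : Matrix ι ι ℝ} (hA : A.PosDef) (hx : x.PosSemidef)
    (h0 : x ≠ 0) : 0 < (A * x).trace :=
  (trace_mul_nonneg_of_posDef hA hx).1.lt_of_ne
    fun h => h0 ((trace_mul_nonneg_of_posDef hA hx).2 h.symm)

/-- Strict monotonicity of matrix inversion on the positive definite matrices. -/
theorem eq_of_trace_inv_sub_mul_sub {x y : Matrix ι ι ℝ} (hx : x.PosDef) (hy : y.PosDef)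
    (h : ((x⁻¹ - y⁻¹) * (x - y)).trace = 0) : x = y := by
  have hxu := (isUnit_iff_isUnit_det _).1 hx.isUnit
  have hyu := (isUnit_iff_isUnit_det _).1 hy.isUnit
  have hd : (x - y)ᴴ = x - y := hx.isHermitian.sub hy.isHermitian
  have hid : (x⁻¹ - y⁻¹) * (x - y) = -(x⁻¹ * ((x - y) * y⁻¹ * (x - y)ᴴ)) := by
    rw [hd]
    have : x⁻¹ - y⁻¹ = -(x⁻¹ * (x - y) * y⁻¹) := by
      rw [mul_sub, sub_mul, nonsing_inv_mul _ hxu, one_mul, mul_assoc, mul_nonsing_inv _ hyu,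
        mul_one, neg_sub]
    rw [this, neg_mul]
    simp only [mul_assoc]
  have hps := hy.inv.posSemidef.mul_mul_conjTranspose_same (x - y)
  rw [hid, trace_neg, neg_eq_zero] at h
  have h1 := (trace_mul_nonneg_of_posDef hx.inv hps).2 h
  have h2 : (y⁻¹ * ((x - y)ᴴ * (x - y))).trace = 0 := by
    rw [← mul_assoc, trace_mul_comm, ← mul_assoc, h1, trace_zero]
  have h3 := (trace_mul_nonneg_of_posDef hy.inv (posSemidef_conjTranspose_mul_self (x - y))).2 h2
  exact sub_eq_zero.1 (conjTranspose_mul_self_eq_zero.1 h3)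

end PositiveDefinite

/-- Deleting the first row and column of a positive definite `F` changes `tr (A F⁻¹)` by a
rank-one term built from the first column of `F⁻¹`. -/
theorem trace_mul_inv_sub_trace_submatrix_mul_inv {k : ℕ}
    {F A : Matrix (Fin (k + 1)) (Fin (k + 1)) ℝ} (hF : F.PosDef) {w : Fin (k + 1) → ℝ} (hw : F *ᵥ w = Pi.single 0 1) (hw0 : w 0 ≠ 0) :
    (A * F⁻¹).trace - (A.submatrix Fin.succ Fin.succ * (F.submatrix Fin.succ Fin.succ)⁻¹).trace
      = (w 0)⁻¹ * (w ⬝ᵥ A *ᵥ w) := by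
  have hG := hF.submatrix (Fin.succ_injective k)
  set G := F.submatrix Fin.succ Fin.succ with hGdef
  have hGu := (isUnit_iff_isUnit_det _).1 hG.isUnit
  have hFs : ∀ i j, F i j = F j i := fun i j => by simpa using hF.isHermitian.apply j i
  have hGG : ∀ i j : Fin k, ∑ c, F i.succ c.succ * G⁻¹ c j = if i = j then 1 else 0 := fun i j => by
    have := congrFun (congrFun (mul_nonsing_inv G hGu) i) j
    rwa [mul_apply, one_apply] at this
  let E : Matrix (Fin (k + 1)) (Fin (k + 1)) ℝ :=
    Matrix.of fun i j => Fin.cases 0 (fun i' => Fin.cases 0 (fun j' => G⁻¹ i' j') j) i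
  have hE00 : ∀ j, E 0 j = 0 := fun j => rfl
  have hE0 : ∀ i, E i 0 = 0 := fun i => by cases i using Fin.cases <;> rfl
  have hEs : ∀ i j : Fin k, E i.succ j.succ = G⁻¹ i j := fun i j => rfl
  have hwi : ∀ i, ∑ c, F i c * w c = if i = 0 then 1 else 0 := fun i => by
    have := congrFun hw i
    rwa [mulVec, dotProduct, Pi.single_apply] at this
  have hrow : ∀ j : Fin k, ∑ c : Fin k, F 0 c.succ * G⁻¹ c j = -((w 0)⁻¹ * w j.succ) := fun j => by
    have h1 : ∀ c : Fin k,
        F 0 c.succ * w 0 = -∑ d : Fin k, F c.succ d.succ * w d.succ := fun c => by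
      have := hwi c.succ
      rw [Fin.sum_univ_succ, if_neg (Fin.succ_ne_zero c), hFs] at this
      linarith
    have h2 : (∑ c : Fin k, F 0 c.succ * G⁻¹ c j) * w 0 = -w j.succ := by
      have h3 : ∀ c : Fin k, F 0 c.succ * G⁻¹ c j * w 0
          = -∑ d : Fin k, F d.succ c.succ * G⁻¹ c j * w d.succ := fun c => by
        rw [mul_right_comm, h1, neg_mul, Finset.sum_mul]
        exact congrArg _ (Finset.sum_congr rfl fun d _ => by rw [hFs]; ring)
      rw [Finset.sum_mul, Finset.sum_congr rfl fun c _ => h3 c, Finset.sum_neg_distrib,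
        Finset.sum_comm]
      simp_rw [← Finset.sum_mul, hGG]
      simp
    refine mul_right_cancel₀ hw0 (h2.trans ?_)
    field_simp
  have hinv : F⁻¹ = E + (w 0)⁻¹ • vecMulVec w w := by
    apply inv_eq_right_inv
    rw [mul_add, mul_smul_comm, mul_vecMulVec, hw]
    ext i j
    rw [Matrix.add_apply, Matrix.smul_apply, vecMulVec_apply, mul_apply, Fin.sum_univ_succ, hE00,
      mul_zero, zero_add, smul_eq_mul, one_apply]
    cases j using Fin.cases with
    | zero =>
      simp only [hE0, mul_zero, Finset.sum_const_zero, zero_add, Pi.single_apply]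
      split_ifs <;> field_simp
    | succ j =>
      simp only [hEs]
      cases i using Fin.cases with
      | zero => rw [hrow]; simp [(Fin.succ_ne_zero j).symm]
      | succ i => rw [hGG]; simp [Fin.succ_inj]
  have hAE : (A * E).trace = (A.submatrix Fin.succ Fin.succ * G⁻¹).trace := by
    simp only [trace, diag_apply, mul_apply]
    rw [Fin.sum_univ_succ]
    simp [Fin.sum_univ_succ, hE0, hE00, hEs]
  have hAw : (A * vecMulVec w w).trace = w ⬝ᵥ A *ᵥ w := by
    rw [mul_vecMulVec, trace_vecMulVec, dotProduct_comm]
  rw [hinv, mul_add, trace_add, hAE, mul_smul_comm, trace_smul, hAw]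
  simp

/-! ### Block triangular matrices and the space `𝒵` -/

theorem blk_mul (A B : Mat r n) (l k : Fin (r + 1)) :
    blk (A * B) l k = ∑ j, blk A l j * blk B j k := by
  ext a b
  simp [blk, mul_apply, Matrix.sum_apply, Fintype.sum_sigma]

theorem blk_add (A B : Mat r n) (l k : Fin (r + 1)) : blk (A + B) l k = blk A l k + blk B l k :=
  rfl

theorem blk_smul (t : ℝ) (A : Mat r n) (l k : Fin (r + 1)) : blk (t • A) l k = t • blk A l k :=
  rfl

theorem blk_transpose (A : Mat r n) (l k : Fin (r + 1)) : blk Aᵀ l k = (blk A k l)ᵀ := rfl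

theorem blk_one (k : Fin (r + 1)) : blk (1 : Mat r n) k k = 1 := by
  ext a b
  simp [blk, one_apply]

theorem blk_one_of_ne {l k : Fin (r + 1)} (h : l ≠ k) : blk (1 : Mat r n) l k = 0 := by
  ext a b
  simp [blk, one_apply, h]

theorem forall_apply_eq_ite_iff {x : Mat r n} {k : Fin (r + 1)} {c : ℝ} :
    (∀ a b : Fin (n k), x ⟨k, a⟩ ⟨k, b⟩ = if a = b then c else 0) ↔ blk x k k = c • 1 := by
  constructor
  · intro h
    ext a b
    simp [blk, h, one_apply]
  · intro h a b
    have := congrFun (congrFun h a) b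
    simpa [blk, one_apply] using this

theorem tdiag_of_blk {x : Mat r n} {k : Fin (r + 1)} {c : ℝ} (h : blk x k k = c • 1) :
    tdiag x k = c := by
  rw [tdiag, forall_apply_eq_ite_iff.2 h, if_pos rfl]

/-- The space `𝒵` as a submodule. -/
def Zsub : Submodule ℝ (Mat r n) where
  carrier := {x | x.IsSymm ∧ (∀ k l, k < l → blk x l k ∈ V l k) ∧ ∀ k, ∃ c : ℝ, blk x k k = c • 1}
  add_mem' {x y} hx hy := by
    refine ⟨hx.1.add hy.1, fun k l h => (V l k).add_mem (hx.2.1 k l h) (hy.2.1 k l h), fun k => ?_⟩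
    obtain ⟨c, hc⟩ := hx.2.2 k
    obtain ⟨d, hd⟩ := hy.2.2 k
    exact ⟨c + d, by rw [blk_add, hc, hd, add_smul]⟩
  zero_mem' := ⟨isSymm_zero, fun k l _ => (V l k).zero_mem, fun k => ⟨0, by rw [zero_smul]; rfl⟩⟩
  smul_mem' t x hx := by
    refine ⟨hx.1.smul t, fun k l h => (V l k).smul_mem t (hx.2.1 k l h), fun k => ?_⟩
    obtain ⟨c, hc⟩ := hx.2.2 k
    exact ⟨t * c, by rw [blk_smul, hc, mul_smul]⟩

theorem mem_Zspace_iff {x : Mat r n} : x ∈ Zspace V ↔ x ∈ Zsub V := by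
  simp only [Zspace, forall_apply_eq_ite_iff]
  rfl

/-- The algebra of block lower triangular matrices with strictly lower blocks in `𝒱_{lk}` and
scalar diagonal blocks. -/
def Lsub : Submodule ℝ (Mat r n) where
  carrier := {T | (∀ k l, l < k → blk T l k = 0) ∧ (∀ k l, k < l → blk T l k ∈ V l k) ∧
    ∀ k, ∃ t : ℝ, blk T k k = t • 1}
  add_mem' {x y} hx hy := by
    refine ⟨fun k l h => ?_, fun k l h => (V l k).add_mem (hx.2.1 k l h) (hy.2.1 k l h),
      fun k => ?_⟩
    · rw [blk_add, hx.1 k l h, hy.1 k l h, add_zero]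
    obtain ⟨c, hc⟩ := hx.2.2 k
    obtain ⟨d, hd⟩ := hy.2.2 k
    exact ⟨c + d, by rw [blk_add, hc, hd, add_smul]⟩
  zero_mem' := ⟨fun k l _ => rfl, fun k l _ => (V l k).zero_mem,
    fun k => ⟨0, by rw [zero_smul]; rfl⟩⟩
  smul_mem' t x hx := by
    refine ⟨fun k l h => ?_, fun k l h => (V l k).smul_mem t (hx.2.1 k l h), fun k => ?_⟩
    · rw [blk_smul, hx.1 k l h, smul_zero]
    obtain ⟨c, hc⟩ := hx.2.2 k
    exact ⟨t * c, by rw [blk_smul, hc, mul_smul]⟩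

variable {V}

theorem blk_eq_tdiag_smul {T : Mat r n} (hT : T ∈ Lsub V) (k : Fin (r + 1)) :
    blk T k k = tdiag T k • 1 := by
  obtain ⟨t, ht⟩ := hT.2.2 k
  rw [tdiag_of_blk ht, ht]

theorem mem_Hgrp_iff {T : Mat r n} : T ∈ Hgrp V ↔ T ∈ Lsub V ∧ ∀ k, 0 < tdiag T k := by
  simp only [Hgrp, forall_apply_eq_ite_iff]
  constructor
  · rintro ⟨h1, h2, h3⟩
    refine ⟨⟨h1, h2, fun k => (h3 k).imp fun _ h => h.2⟩, fun k => ?_⟩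
    obtain ⟨t, ht, hk⟩ := h3 k
    rwa [tdiag_of_blk hk]
  · rintro ⟨h, hpos⟩
    exact ⟨h.1, h.2.1, fun k => ⟨_, hpos k, blk_eq_tdiag_smul h k⟩⟩

theorem one_mem_Zsub : (1 : Mat r n) ∈ Zsub V :=
  ⟨isSymm_one, fun k l h => blk_one_of_ne (n := n) h.ne' ▸ (V l k).zero_mem,
    fun k => ⟨1, by rw [one_smul, blk_one]⟩⟩

theorem one_mem_Lsub : (1 : Mat r n) ∈ Lsub V :=
  ⟨fun _ _ h => blk_one_of_ne h.ne, fun k l h => blk_one_of_ne (n := n) h.ne' ▸ (V l k).zero_mem,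
    fun k => ⟨1, by rw [one_smul, blk_one]⟩⟩

theorem blk_mul_self {A B : Mat r n} (hA : A ∈ Lsub V) (hB : B ∈ Lsub V) (k : Fin (r + 1)) :
    blk (A * B) k k = (tdiag A k * tdiag B k) • 1 := by
  rw [blk_mul, Finset.sum_eq_single k]
  · rw [blk_eq_tdiag_smul hA, blk_eq_tdiag_smul hB, smul_mul_smul_comm, one_mul]
  · intro j _ hj
    rcases hj.lt_or_gt with h | h
    · rw [hB.1 _ _ h, Matrix.mul_zero]
    · rw [hA.1 _ _ h, Matrix.zero_mul]
  · simp

theorem tdiag_mul {A B : Mat r n} (hA : A ∈ Lsub V) (hB : B ∈ Lsub V) (k : Fin (r + 1)) :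
    tdiag (A * B) k = tdiag A k * tdiag B k :=
  tdiag_of_blk (blk_mul_self hA hB k)

theorem mul_mem_Lsub (hV1 : CondV1 V) {A B : Mat r n} (hA : A ∈ Lsub V) (hB : B ∈ Lsub V) :
    A * B ∈ Lsub V := by
  refine ⟨fun k l h => ?_, fun k l h => ?_, fun k => ⟨_, blk_mul_self hA hB k⟩⟩
  · rw [blk_mul]
    refine Finset.sum_eq_zero fun j _ => ?_
    rcases lt_or_ge j k with hj | hj
    · rw [hB.1 _ _ hj, Matrix.mul_zero]
    · rw [hA.1 _ _ (h.trans_le hj), Matrix.zero_mul]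
  · rw [blk_mul]
    refine (V l k).sum_mem fun j _ => ?_
    rcases lt_trichotomy j k with hj | rfl | hj
    · rw [hB.1 _ _ hj, Matrix.mul_zero]
      exact (V l k).zero_mem
    · rw [blk_eq_tdiag_smul hB, Matrix.mul_smul, Matrix.mul_one]
      exact (V l j).smul_mem _ (hA.2.1 _ _ h)
    · rcases lt_trichotomy l j with hj' | rfl | hj'
      · rw [hA.1 _ _ hj', Matrix.zero_mul]
        exact (V l k).zero_mem
      · rw [blk_eq_tdiag_smul hA, Matrix.smul_mul, Matrix.one_mul]
        exact (V l k).smul_mem _ (hB.2.1 _ _ h)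
      · exact hV1 _ _ _ hj hj' _ (hA.2.1 _ _ hj') _ (hB.2.1 _ _ hj)

theorem mul_transpose_self_mem_Zsub (hV2 : CondV2 V) (hV3 : CondV3 V) {A : Mat r n}
    (hA : A ∈ Lsub V) : A * Aᵀ ∈ Zsub V := by
  refine ⟨by simp [IsSymm], fun k l h => ?_, fun k => ?_⟩
  · rw [blk_mul]
    refine (V l k).sum_mem fun j _ => ?_
    rw [blk_transpose]
    rcases lt_trichotomy j k with hj | rfl | hj
    · exact hV2 _ _ _ hj h _ (hA.2.1 _ _ (hj.trans h)) _ (hA.2.1 _ _ hj)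
    · rw [blk_eq_tdiag_smul hA, transpose_smul, transpose_one, Matrix.mul_smul, Matrix.mul_one]
      exact (V l j).smul_mem _ (hA.2.1 _ _ h)
    · rw [hA.1 _ _ hj, transpose_zero, Matrix.mul_zero]
      exact (V l k).zero_mem
  · have hj (j : Fin (r + 1)) : ∃ c : ℝ, blk A k j * (blk A k j)ᵀ = c • 1 := by
      rcases lt_trichotomy j k with hj | rfl | hj
      · exact hV3 _ _ hj _ (hA.2.1 _ _ hj)
      · exact ⟨_, by rw [blk_eq_tdiag_smul hA, transpose_smul, transpose_one, smul_mul_smul_comm,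
          one_mul]⟩
      · exact ⟨0, by rw [hA.1 _ _ hj, Matrix.zero_mul, zero_smul]⟩
    choose c hc using hj
    refine ⟨∑ j, c j, ?_⟩
    rw [blk_mul, Finset.sum_smul]
    exact Finset.sum_congr rfl fun j _ => hc j

theorem mul_transpose_add_mem_Zsub (hV2 : CondV2 V) (hV3 : CondV3 V) {A B : Mat r n}
    (hA : A ∈ Lsub V) (hB : B ∈ Lsub V) : A * Bᵀ + B * Aᵀ ∈ Zsub V := by
  have h := (Zsub V).sub_mem ((Zsub V).sub_mem
    (mul_transpose_self_mem_Zsub hV2 hV3 ((Lsub V).add_mem hA hB))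
    (mul_transpose_self_mem_Zsub hV2 hV3 hA)) (mul_transpose_self_mem_Zsub hV2 hV3 hB)
  convert h using 1
  rw [transpose_add]
  noncomm_ring

/-- Every element of `𝒵` is the sum of a block triangular matrix and its transpose. -/
theorem exists_eq_add_transpose {a : Mat r n} (ha : a ∈ Zsub V) :
    ∃ L ∈ Lsub V, a = L + Lᵀ := by
  let L : Mat r n := Matrix.of fun p q =>
    if q.1 < p.1 then a p q else if p.1 = q.1 then (2⁻¹ : ℝ) * a p q else 0
  refine ⟨L, ⟨fun k l h => ?_, fun k l h => ?_, fun k => ?_⟩, ?_⟩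
  · ext b c
    simp [L, blk, h.not_gt, h.ne]
  · convert ha.2.1 k l h using 1
    ext b c
    simp [L, blk, h]
  · obtain ⟨c, hc⟩ := ha.2.2 k
    refine ⟨2⁻¹ * c, ?_⟩
    rw [mul_smul, ← hc]
    ext b c
    simp [L, blk]
  · ext p q
    have hs : a q p = a p q := ha.1.apply p q
    simp only [Matrix.add_apply, transpose_apply, L, of_apply]
    rcases lt_trichotomy p.1 q.1 with h | h | h
    · simp [h, h.not_gt, h.ne, hs]
    · simp only [h, lt_irrefl, if_true, if_false, hs]
      ring
    · simp [h, h.not_gt, h.ne]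

theorem mul_mul_transpose_mem_Zsub (hV1 : CondV1 V) (hV2 : CondV2 V) (hV3 : CondV3 V)
    {S a : Mat r n} (hS : S ∈ Lsub V) (ha : a ∈ Zsub V) : S * a * Sᵀ ∈ Zsub V := by
  obtain ⟨L, hL, rfl⟩ := exists_eq_add_transpose ha
  convert mul_transpose_add_mem_Zsub hV2 hV3 (mul_mem_Lsub hV1 hS hL) hS using 1
  rw [transpose_mul]
  noncomm_ring

theorem mulVec_eq_zero_of_tdiag_ne_zero {S : Mat r n} (hS : S ∈ Lsub V) (h : ∀ k, tdiag S k ≠ 0)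
    {v : Idx r n → ℝ} (hv : S *ᵥ v = 0) : v = 0 := by
  have key (k : Fin (r + 1)) : ∀ a : Fin (n k), v ⟨k, a⟩ = 0 := by
    induction k using WellFoundedLT.induction with
    | ind k ih =>
      intro a
      have h1 := congrFun hv ⟨k, a⟩
      rw [mulVec, dotProduct, Fintype.sum_sigma, Finset.sum_eq_single k] at h1
      · simp only [forall_apply_eq_ite_iff.2 (blk_eq_tdiag_smul hS k), ite_mul, zero_mul,
          Finset.sum_ite_eq, Finset.mem_univ, if_true, Pi.zero_apply] at h1
        exact (mul_eq_zero.1 h1).resolve_left (h k)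
      · intro j _ hj
        refine Finset.sum_eq_zero fun b _ => ?_
        rcases hj.lt_or_gt with hj | hj
        · rw [ih j hj, mul_zero]
        · rw [show S ⟨k, a⟩ ⟨j, b⟩ = 0 from congrFun (congrFun (hS.1 _ _ hj) a) b, zero_mul]
      · simp
  ext ⟨k, a⟩
  exact key k a

theorem isUnit_of_tdiag_ne_zero {S : Mat r n} (hS : S ∈ Lsub V) (h : ∀ k, tdiag S k ≠ 0) :
    IsUnit S := by
  rw [← mulVec_injective_iff_isUnit]
  intro v w hvw
  refine sub_eq_zero.1 (mulVec_eq_zero_of_tdiag_ne_zero hS h ?_)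
  rw [mulVec_sub, sub_eq_zero]
  exact hvw

/-- A finite-dimensional algebra of matrices contains the inverses of its elements. -/
theorem inv_mem_Lsub (hV1 : CondV1 V) {S : Mat r n} (hS : S ∈ Lsub V) (hu : IsUnit S) :
    S⁻¹ ∈ Lsub V := by
  let f : Lsub V →ₗ[ℝ] Lsub V :=
    (LinearMap.mulLeft ℝ S).restrict fun _ hx => mul_mem_Lsub hV1 hS hx
  have hf : Function.Injective f := fun x y hxy =>
    Subtype.ext (hu.mul_left_cancel (congrArg Subtype.val hxy))
  obtain ⟨T, hT⟩ := LinearMap.injective_iff_surjective.1 hf ⟨1, one_mem_Lsub⟩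
  rw [inv_eq_right_inv (congrArg Subtype.val hT : S * T = 1)]
  exact T.2

theorem inv_mem_Hgrp (hV1 : CondV1 V) {S : Mat r n} (hS : S ∈ Hgrp V) : S⁻¹ ∈ Hgrp V := by
  rw [mem_Hgrp_iff] at hS ⊢
  have hu := isUnit_of_tdiag_ne_zero hS.1 fun k => (hS.2 k).ne'
  have hi := inv_mem_Lsub hV1 hS.1 hu
  refine ⟨hi, fun k => ?_⟩
  have h := tdiag_mul hS.1 hi k
  rw [mul_nonsing_inv _ ((isUnit_iff_isUnit_det _).1 hu),
    tdiag_of_blk (c := 1) (by rw [blk_one, one_smul])] at h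
  exact pos_of_mul_pos_right (h ▸ one_pos) (hS.2 k).le

theorem trace_eq_sum_tdiag {L : Mat r n} (hL : L ∈ Lsub V) :
    L.trace = ∑ k, ((n k : ℕ) : ℝ) * tdiag L k := by
  rw [trace, Fintype.sum_sigma]
  refine Finset.sum_congr rfl fun k _ => ?_
  simp [forall_apply_eq_ite_iff.2 (blk_eq_tdiag_smul hL k)]

/-! ### The trace inner product and the cones -/

theorem tip_comm (x y : Mat r n) : tip x y = tip y x := trace_mul_comm x y

theorem tip_sub_left (x y z : Mat r n) : tip (x - y) z = tip x z - tip y z := by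
  rw [tip, sub_mul, trace_sub]; rfl

theorem tip_sub_right (x y z : Mat r n) : tip x (y - z) = tip x y - tip x z := by
  rw [tip, mul_sub, trace_sub]; rfl

theorem tip_add_right (x y z : Mat r n) : tip x (y + z) = tip x y + tip x z := by
  rw [tip, mul_add, trace_add]; rfl

theorem tip_smul_right (x y : Mat r n) (c : ℝ) : tip x (c • y) = c * tip x y := by
  rw [tip, mul_smul_comm, trace_smul]; rfl

theorem tip_transpose_right {x : Mat r n} (hx : x.IsSymm) (y : Mat r n) : tip x yᵀ = tip x y := by
  rw [tip, ← trace_transpose, transpose_mul, transpose_transpose, hx.eq, trace_mul_comm]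
  rfl

theorem eq_of_forall_tip_eq {x y : Mat r n} (hx : x ∈ Zsub V) (hy : y ∈ Zsub V)
    (h : ∀ ξ ∈ Zsub V, tip ξ x = tip ξ y) : x = y := by
  have hd := (Zsub V).sub_mem hx hy
  have h0 : tip (x - y) (x - y) = 0 := by rw [tip_sub_right, h _ hd, sub_self]
  have hH : (x - y)ᴴ = x - y := by rw [conjTranspose_eq_transpose_of_trivial]; exact hd.1
  rw [tip] at h0
  nth_rw 1 [← hH] at h0
  exact sub_eq_zero.1 (trace_conjTranspose_mul_self_eq_zero_iff.1 h0)

theorem closure_Pcone_subset_Zsub : closure (Pcone V) ⊆ (Zsub V : Set (Mat r n)) :=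
  closure_minimal (fun _ hx => (mem_Zspace_iff V).1 hx.1)
    (Submodule.closed_of_finiteDimensional (Zsub V))

theorem mem_closure_Pcone {x : Mat r n} (hx : x ∈ Zsub V) (hps : x.PosSemidef) :
    x ∈ closure (Pcone V) := by
  have hc : Continuous fun ε : ℝ => x + ε • (1 : Mat r n) := by fun_prop
  have ht := (hc.tendsto 0).mono_left (nhdsWithin_le_nhds (s := Set.Ioi 0))
  rw [zero_smul, add_zero] at ht
  refine mem_closure_of_tendsto ht ?_
  filter_upwards [self_mem_nhdsWithin] with ε hε
  exact ⟨(mem_Zspace_iff V).2 ((Zsub V).add_mem hx ((Zsub V).smul_mem _ one_mem_Zsub)),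
    PosDef.posSemidef_add hps (PosDef.one.smul hε)⟩

/-! ### Columns of block triangular matrices -/

variable {i : Fin (r + 1)}

theorem WGood.add {p p' : Wparam r n i} (hp : WGood V i p) (hp' : WGood V i p') :
    WGood V i (p + p') :=
  ⟨fun l h => (V l i).add_mem (hp.1 l h) (hp'.1 l h), fun l h => by
    rw [Prod.snd_add, Pi.add_apply, hp.2 l h, hp'.2 l h, add_zero]⟩

theorem WGood.smul {p : Wparam r n i} (hp : WGood V i p) (c : ℝ) : WGood V i (c • p) :=
  ⟨fun l h => (V l i).smul_mem c (hp.1 l h), fun l h => by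
    rw [Prod.smul_snd, Pi.smul_apply, hp.2 l h, smul_zero]⟩

theorem WGood.zero : WGood V i (0 : Wparam r n i) :=
  ⟨fun l _ => (V l i).zero_mem, fun _ _ => rfl⟩

theorem toW_add (p p' : Wparam r n i) : toW i (p + p') = toW i p + toW i p' := by
  ext q b
  simp only [toW, of_apply, Matrix.add_apply, Prod.fst_add, Prod.snd_add, Pi.add_apply]
  split_ifs <;> simp

theorem toW_zero : toW i (0 : Wparam r n i) = 0 := by
  ext q b
  simp [toW]

theorem eq_zero_of_toW_eq_zero {p : Wparam r n i} (hp : WGood V i p) (h : toW i p = 0) :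
    p = 0 := by
  refine Prod.ext ?_ (funext fun l => ?_)
  · simpa [toW] using congrFun (congrFun h ⟨i, ⟨0, (n i).2⟩⟩) ⟨0, (n i).2⟩
  · by_cases hl : i < l
    · ext a b
      simpa [toW, hl, hl.ne'] using congrFun (congrFun h ⟨l, a⟩) b
    · exact hp.2 l hl

/-- The matrix whose `i`-th block column is the element of `W_i` with parameters `p i`. -/
def ofCols (p : ∀ i, Wparam r n i) : Mat r n :=
  Matrix.of fun q c => toW c.1 (p c.1) q c.2

theorem blk_ofCols_self (p : ∀ i, Wparam r n i) (k : Fin (r + 1)) :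
    blk (ofCols p) k k = (p k).1 • 1 := by
  ext a b
  simp [blk, ofCols, toW, one_apply, Fin.ext_iff]

theorem ofCols_mem_Lsub {p : ∀ i, Wparam r n i} (hp : ∀ i, WGood V i (p i)) :
    ofCols p ∈ Lsub V := by
  refine ⟨fun k l h => ?_, fun k l h => ?_, fun k => ⟨_, blk_ofCols_self p k⟩⟩
  · ext a b
    simp [blk, ofCols, toW, h.ne, h.not_gt]
  · convert (hp k).1 l h using 1
    ext a b
    simp [blk, ofCols, toW, h.ne', h]

/-- Parameters of the `i`-th block column of a block triangular matrix. -/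
def colParam (T : Mat r n) (i : Fin (r + 1)) : Wparam r n i :=
  (tdiag T i, fun l => if i < l then blk T l i else 0)

theorem WGood_colParam {T : Mat r n} (hT : T ∈ Lsub V) (i : Fin (r + 1)) :
    WGood V i (colParam T i) :=
  ⟨fun l h => by simpa [colParam, h] using hT.2.1 _ _ h, fun l h => by simp [colParam, h]⟩

theorem colParam_ofCols {p : ∀ i, Wparam r n i} (hp : ∀ i, WGood V i (p i)) (i : Fin (r + 1)) :
    colParam (ofCols p) i = p i := by
  refine Prod.ext (tdiag_of_blk (blk_ofCols_self p i)) (funext fun l => ?_)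
  by_cases hl : i < l
  · ext a b
    simp [colParam, hl, blk, ofCols, toW, hl.ne']
  · simp [colParam, hl, (hp i).2 l hl]

theorem toW_colParam {T : Mat r n} (hT : T ∈ Lsub V) (i : Fin (r + 1)) :
    toW i (colParam T i) = Matrix.of fun q b => T q ⟨i, b⟩ := by
  ext ⟨l, a⟩ b
  rcases lt_trichotomy l i with h | rfl | h
  · have := congrFun (congrFun (hT.1 _ _ h) a) b
    simpa [toW, h.ne, h.not_gt, blk] using this.symm
  · simp [toW, colParam, forall_apply_eq_ite_iff.2 (blk_eq_tdiag_smul hT l), Fin.ext_iff]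
  · simp [toW, colParam, h, h.ne', blk]

theorem mul_transpose_eq_sum {A B : Mat r n} (hA : A ∈ Lsub V) (hB : B ∈ Lsub V) :
    A * Bᵀ = ∑ i, toW i (colParam A i) * (toW i (colParam B i))ᵀ := by
  ext q q'
  simp [toW_colParam hA, toW_colParam hB, mul_apply, Matrix.sum_apply, Fintype.sum_sigma]

theorem toW_mul_transpose_mem_Zsub (hV2 : CondV2 V) (hV3 : CondV3 V) {p : Wparam r n i}
    (hp : WGood V i p) : toW i p * (toW i p)ᵀ ∈ Zsub V := by
  let P : ∀ j, Wparam r n j := Function.update 0 i p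
  have hP (j : Fin (r + 1)) : WGood V j (P j) := by
    by_cases h : j = i
    · subst h
      simpa [P] using hp
    · simpa [P, Function.update_of_ne h] using WGood.zero
  have hL := ofCols_mem_Lsub hP
  convert mul_transpose_self_mem_Zsub hV2 hV3 hL using 1
  rw [mul_transpose_eq_sum hL hL, Finset.sum_eq_single i]
  · simp [colParam_ofCols hP, P]
  · intro j _ hj
    simp [colParam_ofCols hP, P, Function.update_of_ne hj, toW_zero]
  · simp

theorem tip_toW_pos (hV2 : CondV2 V) (hV3 : CondV3 V) {m : Mat r n} (hm : m ∈ Qcone V)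
    {p : Wparam r n i} (hp : WGood V i p) (h0 : p ≠ 0) :
    0 < tip m (toW i p * (toW i p)ᵀ) := by
  refine hm.2 _ (mem_closure_Pcone (toW_mul_transpose_mem_Zsub hV2 hV3 hp) ?_) fun h => h0 ?_
  · simpa using posSemidef_self_mul_conjTranspose (toW i p)
  · exact eq_zero_of_toW_eq_zero hp (self_mul_conjTranspose_eq_zero.1 (by simpa using h))

/-! ### The symmetric matrices representing `ξ` on `W_i` -/

section Quadratic

theorem dotProduct_mulVec_comm {ι : Type*} [Fintype ι] {A : Matrix ι ι ℝ} (hA : A.IsSymm)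
    (v w : ι → ℝ) : v ⬝ᵥ A *ᵥ w = w ⬝ᵥ A *ᵥ v := by
  rw [dotProduct_mulVec, ← mulVec_transpose, hA.eq, dotProduct_comm]

theorem IsSymm_ext {ι : Type*} [Fintype ι] [DecidableEq ι] {A B : Matrix ι ι ℝ} (hA : A.IsSymm)
    (hB : B.IsSymm) (h : ∀ v : ι → ℝ, v ⬝ᵥ A *ᵥ v = v ⬝ᵥ B *ᵥ v) : A = B := by
  ext a b
  have h1 := h (Pi.single a 1 + Pi.single b 1)
  have h2 := h (Pi.single a 1)
  have h3 := h (Pi.single b 1)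
  have h4 := hA.apply a b
  have h5 := hB.apply a b
  simp only [mulVec_add, dotProduct_add, add_dotProduct, mulVec_single_one,
    single_one_dotProduct, col_apply] at h1 h2 h3
  linarith

variable {d : ℕ} {vc : Wparam r n i → (Fin (d + 1) → ℝ)}
  {F : Matrix (Fin (d + 1)) (Fin (d + 1)) ℝ} {ξ : Mat r n}

theorem dotProduct_mulVec_eq_tip (hvc : IsLinearMap ℝ vc) (hFs : F.IsSymm)
    (hF : ∀ p, WGood V i p → vc p ⬝ᵥ F *ᵥ vc p = tip ξ (toW i p * (toW i p)ᵀ)) (hξ : ξ.IsSymm)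
    {p p' : Wparam r n i} (hp : WGood V i p) (hp' : WGood V i p') :
    vc p ⬝ᵥ F *ᵥ vc p' = tip ξ (toW i p * (toW i p')ᵀ) := by
  have h1 := hF _ (hp.add hp')
  have h2 := hF _ hp
  have h3 := hF _ hp'
  have h4 := dotProduct_mulVec_comm hFs (vc p') (vc p)
  have h5 := tip_transpose_right hξ (toW i p * (toW i p')ᵀ)
  rw [transpose_mul, transpose_transpose] at h5
  rw [hvc.map_add, toW_add, transpose_add] at h1
  simp only [mulVec_add, dotProduct_add, add_dotProduct, Matrix.mul_add, Matrix.add_mul,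
    tip_add_right] at h1
  linarith

theorem posDef_of_mem_Qcone (hV2 : CondV2 V) (hV3 : CondV3 V) (hξ : ξ ∈ Qcone V)
    (hvc : IsLinearMap ℝ vc) (hsurj : ∀ v, ∃ p, WGood V i p ∧ vc p = v) (hFs : F.IsSymm)
    (hF : ∀ p, WGood V i p → vc p ⬝ᵥ F *ᵥ vc p = tip ξ (toW i p * (toW i p)ᵀ)) : F.PosDef := by
  refine .of_dotProduct_mulVec_pos ((conjTranspose_eq_transpose_of_trivial F).trans hFs)
    fun v hv => ?_
  obtain ⟨p, hp, rfl⟩ := hsurj v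
  rw [star_trivial, hF p hp]
  exact tip_toW_pos hV2 hV3 hξ hp fun h => hv (h ▸ hvc.map_zero)

theorem eq_submatrix_succ (hvc0 : ∀ p, WGood V i p → vc p 0 = p.1)
    (hsurj : ∀ v, ∃ p, WGood V i p ∧ vc p = v) (hFs : F.IsSymm)
    (hF : ∀ p, WGood V i p → vc p ⬝ᵥ F *ᵥ vc p = tip ξ (toW i p * (toW i p)ᵀ))
    {G : Matrix (Fin d) (Fin d) ℝ} (hGs : G.IsSymm)
    (hG : ∀ p, WGood V i p → p.1 = 0 → (fun j => vc p j.succ) ⬝ᵥ G *ᵥ (fun j => vc p j.succ)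
      = tip ξ (toW i p * (toW i p)ᵀ)) : G = F.submatrix Fin.succ Fin.succ := by
  refine IsSymm_ext hGs (hFs.submatrix _) fun v => ?_
  obtain ⟨p, hp, hpv⟩ := hsurj (Fin.cons 0 v)
  have hp0 : p.1 = 0 := by rw [← hvc0 p hp, hpv, Fin.cons_zero]
  have h := (hG p hp hp0).trans (hF p hp).symm
  simpa [hpv, dotProduct, mulVec, Fin.sum_univ_succ] using h

end Quadratic

/-- If `m` agrees on every `W_i` with the differential of `2 n_i log x_{ii}` at the `i`-th block
column of `S`, then `m` is the projection of `(S Sᵀ)⁻¹` to `𝒵`. -/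
theorem tip_inv_mul_transpose_eq (hV1 : CondV1 V) (hV2 : CondV2 V) (hV3 : CondV3 V)
    {m S : Mat r n} (hm : m ∈ Zsub V) (hS : S ∈ Hgrp V)
    (hcrit : ∀ i p, WGood V i p →
      tip m (toW i p * (toW i (colParam S i))ᵀ) = (n i : ℕ) * (tdiag S i)⁻¹ * p.1)
    {a : Mat r n} (ha : a ∈ Zsub V) : tip (S * Sᵀ)⁻¹ a = tip m a := by
  obtain ⟨hSL, hSpos⟩ := mem_Hgrp_iff.1 hS
  have hSu := (isUnit_iff_isUnit_det _).1 (isUnit_of_tdiag_ne_zero hSL fun k => (hSpos k).ne')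
  have hSTu : IsUnit Sᵀ.det := by rwa [det_transpose]
  have hTL := (mem_Hgrp_iff.1 (inv_mem_Hgrp hV1 hS)).1
  obtain ⟨L, hL, hLeq⟩ := exists_eq_add_transpose (mul_mul_transpose_mem_Zsub hV1 hV2 hV3 hTL ha)
  have haS : a = S * L * Sᵀ + (S * L * Sᵀ)ᵀ := by
    calc a = S * (S⁻¹ * a * S⁻¹ᵀ) * Sᵀ := by
          simp only [mul_assoc, transpose_nonsing_inv, nonsing_inv_mul _ hSTu, mul_one,
            mul_nonsing_inv_cancel_left _ _ hSu]
      _ = _ := by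
          rw [hLeq, transpose_mul, transpose_mul, transpose_transpose]
          noncomm_ring
  have hleft : tip (S * Sᵀ)⁻¹ a = 2 * L.trace := by
    calc tip (S * Sᵀ)⁻¹ a = (S⁻¹ * a * S⁻¹ᵀ).trace := by
          rw [tip, Matrix.mul_inv_rev, transpose_nonsing_inv, mul_assoc, trace_mul_comm]
      _ = _ := by rw [hLeq, trace_add, trace_transpose, two_mul]
  have hSL' := mul_mem_Lsub hV1 hSL hL
  have hright : tip m (S * L * Sᵀ) = L.trace := by
    rw [mul_transpose_eq_sum hSL' hSL, trace_eq_sum_tdiag hL, tip, Finset.mul_sum, trace_sum]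
    refine Finset.sum_congr rfl fun i _ => ?_
    have h := hcrit i _ (WGood_colParam hSL' i)
    rw [tip] at h
    rw [h, show (colParam (S * L) i).1 = tdiag S i * tdiag L i from tdiag_mul hSL hL i]
    have := (hSpos i).ne'
    field_simp
  rw [hleft, haS, tip_add_right, tip_transpose_right hm.1, hright, two_mul]

theorem mul_transpose_mem_Pcone (hV2 : CondV2 V) (hV3 : CondV3 V) {S : Mat r n}
    (hS : S ∈ Hgrp V) : S * Sᵀ ∈ Pcone V := by
  obtain ⟨hSL, hSpos⟩ := mem_Hgrp_iff.1 hS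
  refine ⟨(mem_Zspace_iff V).2 (mul_transpose_self_mem_Zsub hV2 hV3 hSL), ?_⟩
  have hu := isUnit_of_tdiag_ne_zero hSL fun k => (hSpos k).ne'
  simpa using PosDef.mul_conjTranspose_self S (vecMul_injective_iff_isUnit.2 hu)

theorem proj_inv_mem_Qcone {y m : Mat r n} (hy : y ∈ Pcone V) (hm : m ∈ Zsub V)
    (h : ∀ a ∈ Zsub V, tip m a = tip y⁻¹ a) : m ∈ Qcone V := by
  refine ⟨(mem_Zspace_iff V).2 hm, fun x hx h0 => ?_⟩
  rw [h x (closure_Pcone_subset_Zsub hx)]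
  exact trace_mul_pos_of_posDef hy.2.inv
    (posSemidef_of_mem_closure (fun z hz => hz.2.posSemidef) hx) h0

theorem eq_of_tip_inv_eq {x y : Mat r n} (hx : x ∈ Pcone V) (hy : y ∈ Pcone V)
    (h : ∀ a ∈ Zsub V, tip x⁻¹ a = tip y⁻¹ a) : x = y := by
  refine eq_of_trace_inv_sub_mul_sub hx.2 hy.2 ?_
  have hd := (Zsub V).sub_mem ((mem_Zspace_iff V).1 hx.1) ((mem_Zspace_iff V).1 hy.1)
  change tip (x⁻¹ - y⁻¹) (x - y) = 0
  rw [tip_sub_left, h _ hd, sub_self]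

/-- **generalized Lauritzen formula.** The map `𝒫 → 𝒬`, `y ↦ π(y⁻¹)`, is a
bijection, and its inverse sends `m ∈ 𝒬` to
`m̂⁻¹ = n_r φ_r^*(φ_r(m)⁻¹) + Σ_{i<r} n_i (φ_i^*(φ_i(m)⁻¹) - φ̌_i^*(φ̌_i(m)⁻¹))`. -/
theorem statement9 (r : ℕ) (n : Fin (r + 1) → ℕ+)
    (V : ∀ l k : Fin (r + 1), Submodule ℝ (Matrix (Fin (n l)) (Fin (n k)) ℝ))
    (hV1 : CondV1 V) (hV2 : CondV2 V) (hV3 : CondV3 V)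
    (rstar : Mat r n → Mat r n → Mat r n)
    (hrstar : ∀ T ∈ Hgrp V, ∀ ξ ∈ Zspace V, rstar T ξ ∈ Zspace V ∧
      ∀ x ∈ Zspace V, tip (rstar T ξ) x = tip ξ (rhoM T x))
    (piL : Mat r n → Mat r n)
    (hpi : ∀ x : Mat r n, piL x ∈ Zspace V ∧ ∀ a ∈ Zspace V, tip (piL x) a = tip x a)
    (hat : Mat r n → Mat r n)
    (hhat : ∀ T ∈ Hgrp V, hat (rstar T 1) = Tᵀ * T)
    (mdc : Fin (r + 1) → ℕ)
    (hmdc : ∀ i, mdc i = ∑ l ∈ Finset.univ.filter (fun l => i < l), Module.finrank ℝ (V l i))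
    (vc : ∀ i : Fin (r + 1), Wparam r n i → (Fin (mdc i + 1) → ℝ))
    (hvclin : ∀ i, IsLinearMap ℝ (vc i))
    (hvc0 : ∀ i p, WGood V i p → vc i p 0 = p.1)
    (hvcip : ∀ i p p', WGood V i p → WGood V i p' →
      ∑ j, vc i p j * vc i p' j
        = p.1 * p'.1 + ∑ l ∈ Finset.univ.filter (fun l => i < l), bip l (p.2 l) (p'.2 l))
    (hvcsurj : ∀ i (v : Fin (mdc i + 1) → ℝ), ∃ p, WGood V i p ∧ vc i p = v)
    (φ : ∀ i : Fin (r + 1), Mat r n → Matrix (Fin (mdc i + 1)) (Fin (mdc i + 1)) ℝ)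
    (hφ : ∀ i, ∀ ξ ∈ Zspace V, (φ i ξ).IsSymm ∧ ∀ p, WGood V i p →
      vc i p ⬝ᵥ (φ i ξ).mulVec (vc i p) = tip ξ (toW i p * (toW i p)ᵀ))
    (φc : ∀ i : Fin (r + 1), Mat r n → Matrix (Fin (mdc i)) (Fin (mdc i)) ℝ)
    (hφc : ∀ i, ∀ ξ ∈ Zspace V, (φc i ξ).IsSymm ∧ ∀ p, WGood V i p → p.1 = 0 →
      (fun j => vc i p j.succ) ⬝ᵥ (φc i ξ).mulVec (fun j => vc i p j.succ)
        = tip ξ (toW i p * (toW i p)ᵀ))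
    (φs : ∀ i : Fin (r + 1), Matrix (Fin (mdc i + 1)) (Fin (mdc i + 1)) ℝ → Mat r n)
    (hφs : ∀ i (X : Matrix (Fin (mdc i + 1)) (Fin (mdc i + 1)) ℝ), X.IsSymm →
      φs i X ∈ Zspace V ∧ ∀ ξ ∈ Zspace V, tip ξ (φs i X) = (φ i ξ * X).trace)
    (φcs : ∀ i : Fin (r + 1), Matrix (Fin (mdc i)) (Fin (mdc i)) ℝ → Mat r n)
    (hφcs : ∀ i (X : Matrix (Fin (mdc i)) (Fin (mdc i)) ℝ), X.IsSymm →
      φcs i X ∈ Zspace V ∧ ∀ ξ ∈ Zspace V, tip ξ (φcs i X) = (φc i ξ * X).trace) :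
    Set.BijOn (fun y => piL y⁻¹) (Pcone V) (Qcone V) ∧
    ∀ m ∈ Qcone V,
      (hat m)⁻¹ ∈ Pcone V ∧
      piL (((hat m)⁻¹)⁻¹) = m ∧
      (hat m)⁻¹ = ((n (Fin.last r) : ℕ) : ℝ) •
            φs (Fin.last r) ((φ (Fin.last r) m)⁻¹)
        + ∑ i ∈ Finset.univ.filter (fun i => i ≠ Fin.last r),
            ((n i : ℕ) : ℝ) • (φs i ((φ i m)⁻¹) - φcs i ((φc i m)⁻¹)) := by
  have hlast : mdc (Fin.last r) = 0 := by
    rw [hmdc]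
    exact Finset.sum_eq_zero fun l hl =>
      absurd (Finset.mem_filter.1 hl).2 (Fin.le_last l).not_gt
  have hproj {x : Mat r n} {m : Mat r n} (hm : m ∈ Zsub V)
      (h : ∀ a ∈ Zsub V, tip x a = tip m a) : piL x = m := by
    refine eq_of_forall_tip_eq ((mem_Zspace_iff V).1 (hpi x).1) hm fun ξ hξ => ?_
    rw [tip_comm, (hpi x).2 ξ ((mem_Zspace_iff V).2 hξ), h ξ hξ, tip_comm]
  have main (m : Mat r n) (hm : m ∈ Qcone V) : ∃ S ∈ Hgrp V,
      (∀ a ∈ Zsub V, tip (S * Sᵀ)⁻¹ a = tip m a) ∧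
      S * Sᵀ = ∑ i, ((n i : ℕ) : ℝ) • (φs i ((φ i m)⁻¹) - φcs i ((φc i m)⁻¹)) := by
    have hmZ := (mem_Zspace_iff V).1 hm.1
    have hPD (i) : (φ i m).PosDef :=
      posDef_of_mem_Qcone hV2 hV3 hm (hvclin i) (hvcsurj i) (hφ i m hm.1).1 (hφ i m hm.1).2
    have hdet (i) := (isUnit_iff_isUnit_det _).1 (hPD i).isUnit
    have hsub (i) {ξ : Mat r n} (hξ : ξ ∈ Zsub V) :
        φc i ξ = (φ i ξ).submatrix Fin.succ Fin.succ :=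
      have hξ' := (mem_Zspace_iff V).2 hξ
      eq_submatrix_succ (hvc0 i) (hvcsurj i) (hφ i ξ hξ').1 (hφ i ξ hξ').2
        (hφc i ξ hξ').1 (hφc i ξ hξ').2
    let w (i) : Fin (mdc i + 1) → ℝ := (φ i m)⁻¹ *ᵥ Pi.single 0 1
    have hw (i) : φ i m *ᵥ w i = Pi.single 0 1 := by
      rw [mulVec_mulVec, mul_nonsing_inv _ (hdet i), one_mulVec]
    have hw0 (i) : 0 < w i 0 := by
      have h : w i 0 = (φ i m)⁻¹ 0 0 := by simp [w]
      exact h ▸ (hPD i).inv.diag_pos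
    let c (i) : ℝ := √((n i : ℕ) / w i 0)
    have hc (i) : 0 < c i := Real.sqrt_pos.2 (div_pos (Nat.cast_pos.2 (n i).2) (hw0 i))
    have hcc (i) : c i * c i = (n i : ℕ) / w i 0 :=
      Real.mul_self_sqrt (div_pos (Nat.cast_pos.2 (n i).2) (hw0 i)).le
    choose p hp hpw using fun i => hvcsurj i (c i • w i)
    have hp1 (i) : (p i).1 = c i * w i 0 := by rw [← hvc0 i _ (hp i), hpw]; rfl
    have hSL := ofCols_mem_Lsub hp
    have hcol := colParam_ofCols hp
    have htd (i) : tdiag (ofCols p) i = c i * w i 0 := by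
      rw [← hp1, ← hcol]; rfl
    have hS : ofCols p ∈ Hgrp V :=
      mem_Hgrp_iff.2 ⟨hSL, fun i => htd i ▸ mul_pos (hc i) (hw0 i)⟩
    refine ⟨ofCols p, hS, fun a ha => ?_, ?_⟩
    · refine tip_inv_mul_transpose_eq hV1 hV2 hV3 hmZ hS (fun i q hq => ?_) ha
      rw [hcol, htd, ← dotProduct_mulVec_eq_tip (hvclin i) (hφ i m hm.1).1 (hφ i m hm.1).2 hmZ.1
        hq (hp i), hpw, mulVec_smul, hw, dotProduct_smul, dotProduct_single_one, hvc0 i q hq,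
        smul_eq_mul]
      have h1 := (hc i).ne'
      have h2 := (hw0 i).ne'
      have h3 := hcc i
      field_simp at h3 ⊢
      linear_combination q.1 * h3
    · rw [mul_transpose_eq_sum hSL hSL]
      refine Finset.sum_congr rfl fun i _ => ?_
      have hXs : ((φ i m)⁻¹).IsSymm := (conjTranspose_eq_transpose_of_trivial _).symm.trans
        (hPD i).inv.isHermitian
      have hGs : ((φc i m)⁻¹).IsSymm := by
        rw [IsSymm, transpose_nonsing_inv, (hφc i m hm.1).1.eq]
      have hZ₁ := (mem_Zspace_iff V).1 (hφs i _ hXs).1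
      have hZ₂ := (mem_Zspace_iff V).1 (hφcs i _ hGs).1
      rw [hcol]
      refine eq_of_forall_tip_eq (toW_mul_transpose_mem_Zsub hV2 hV3 (hp i))
        ((Zsub V).smul_mem _ ((Zsub V).sub_mem hZ₁ hZ₂)) fun ξ hξ => ?_
      have hξ' := (mem_Zspace_iff V).2 hξ
      rw [tip_smul_right, tip_sub_right, (hφs i _ hXs).2 ξ hξ', (hφcs i _ hGs).2 ξ hξ',
        hsub i hξ, hsub i hmZ, trace_mul_inv_sub_trace_submatrix_mul_inv (hPD i) (hw i) (hw0 i).ne',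
        ← (hφ i ξ hξ').2 _ (hp i), hpw, mulVec_smul, dotProduct_smul, smul_dotProduct,
        smul_eq_mul, smul_eq_mul, ← mul_assoc, hcc, div_eq_mul_inv, mul_assoc]
  have hhatS {m S : Mat r n} (hm : m ∈ Qcone V) (hS : S ∈ Hgrp V)
      (h : ∀ a ∈ Zsub V, tip (S * Sᵀ)⁻¹ a = tip m a) : hat m = (S * Sᵀ)⁻¹ := by
    have hT := inv_mem_Hgrp hV1 hS
    have hI : (1 : Mat r n) ∈ Zspace V := (mem_Zspace_iff V).2 one_mem_Zsub
    have hmT : rstar S⁻¹ 1 = m := by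
      refine eq_of_forall_tip_eq ((mem_Zspace_iff V).1 (hrstar _ hT 1 hI).1)
        ((mem_Zspace_iff V).1 hm.1) fun ξ hξ => ?_
      rw [tip_comm, (hrstar _ hT 1 hI).2 ξ ((mem_Zspace_iff V).2 hξ), tip_comm ξ m, ← h ξ hξ, tip,
        tip, rhoM, one_mul, trace_mul_comm, Matrix.mul_inv_rev, transpose_nonsing_inv, mul_assoc]
    rw [← hmT, hhat _ hT, Matrix.mul_inv_rev, transpose_nonsing_inv]
  have hinv {y : Mat r n} (hy : y ∈ Pcone V) : y⁻¹⁻¹ = y :=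
    nonsing_inv_nonsing_inv _ ((isUnit_iff_isUnit_det _).1 hy.2.isUnit)
  refine ⟨⟨fun y hy => ?_, fun x hx y hy hxy => ?_, fun m hm => ?_⟩, fun m hm => ?_⟩
  · exact proj_inv_mem_Qcone hy ((mem_Zspace_iff V).1 (hpi _).1)
      fun a ha => (hpi _).2 a ((mem_Zspace_iff V).2 ha)
  · refine eq_of_tip_inv_eq hx hy fun a ha => ?_
    have ha' := (mem_Zspace_iff V).2 ha
    rw [← (hpi x⁻¹).2 a ha', ← (hpi y⁻¹).2 a ha']
    exact congrArg (tip · a) hxy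
  · obtain ⟨S, hS, h, -⟩ := main m hm
    exact ⟨S * Sᵀ, mul_transpose_mem_Pcone hV2 hV3 hS, hproj ((mem_Zspace_iff V).1 hm.1) h⟩
  · obtain ⟨S, hS, h, hsum⟩ := main m hm
    have hSP := mul_transpose_mem_Pcone hV2 hV3 hS
    have hφcs0 : φcs (Fin.last r) ((φc (Fin.last r) m)⁻¹) = 0 := by
      have : IsEmpty (Fin (mdc (Fin.last r))) := by rw [hlast]; infer_instance
      have hs := hφcs (Fin.last r) ((φc (Fin.last r) m)⁻¹) (Subsingleton.elim _ _)
      refine eq_of_forall_tip_eq ((mem_Zspace_iff V).1 hs.1) (Zsub V).zero_mem fun ξ hξ => ?_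
      rw [hs.2 ξ ((mem_Zspace_iff V).2 hξ), tip, mul_zero, trace_zero]
      simp [trace]
    rw [hhatS hm hS h, hinv hSP]
    refine ⟨hSP, hproj ((mem_Zspace_iff V).1 hm.1) h, ?_⟩
    rw [hsum, Finset.filter_ne', ← Finset.add_sum_erase _ _ (Finset.mem_univ (Fin.last r)), hφcs0,
      sub_zero]

end Wishart
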